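/- arXiv:1302.1323 — 3 statements merged into one kernel-verified Lean document; each statement's English description precedes it below -/
import Mathlib

section
/- Assume M := h·P1 + 2·h·A1·D + 2·h_d·(P2 − A1·D) − h²·R/((h+b)·P3) > 0, and set y* := √(2·K·D/M) and B* := h·R·y*/(h+b). Then for all y > 0 and all B ∈ ℝ, f(y,B) ≥ f(y*,B*) = P3·√(2·K·D·M), with equality if and only if y = y* and B = B*. -/
/-- Completing both squares in the cost function: `s` is a solution of `M * s ^ 2 = 2 * K * D`. -/
theorem cost_eq_add_squares {h b K D P3 R G M s y : ℝ} (hhb : h + b ≠ 0) (hP3 : P3 ≠ 0)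
    (hR : R ≠ 0) (hy : y ≠ 0) (hM : 2 * G - h ^ 2 * R / ((h + b) * P3) = M)
    (hs : M * s ^ 2 = 2 * K * D) (B : ℝ) :
    (h + b) * B ^ 2 / (2 * R * y) - h * B + G * P3 * y + K * D * P3 / y
      = (h + b) / (2 * R * y) * (B - h * R * y / (h + b)) ^ 2
        + P3 * M / (2 * y) * (y - s) ^ 2 + P3 * (M * s) := by
  have hG : G = (M + h ^ 2 * R / ((h + b) * P3)) / 2 := by linarith
  have hKD : K * D = M * s ^ 2 / 2 := by linarith
  rw [hG, hKD]
  field_simp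
  ring

/-- Global minimum of `f(y,B)` at `(y*, B*)`, with value `P3·√(2KDM)`, unique. -/
theorem stmt_3 (h b K D P3 R : ℝ) (hh : 0 < h) (hb : 0 < b) (hK : 0 < K)
    (hD : 0 < D) (hP3 : 0 < P3) (hR : 0 < R) (P1 P2 A1 h_d : ℝ)
    (hM : 0 < h * P1 + 2 * h * A1 * D + 2 * h_d * (P2 - A1 * D)
        - h ^ 2 * R / ((h + b) * P3)) :
    (fun y B : ℝ =>
        (h + b) * B ^ 2 / (2 * R * y) - h * B
          + (h * P1 / 2 + h * A1 * D + h_d * (P2 - A1 * D)) * P3 * y + K * D * P3 / y)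
      (Real.sqrt (2 * K * D /
          (h * P1 + 2 * h * A1 * D + 2 * h_d * (P2 - A1 * D)
            - h ^ 2 * R / ((h + b) * P3))))
      (h * R * Real.sqrt (2 * K * D /
          (h * P1 + 2 * h * A1 * D + 2 * h_d * (P2 - A1 * D)
            - h ^ 2 * R / ((h + b) * P3))) / (h + b))
      = P3 * Real.sqrt (2 * K * D *
          (h * P1 + 2 * h * A1 * D + 2 * h_d * (P2 - A1 * D)
            - h ^ 2 * R / ((h + b) * P3)))
    ∧ ∀ y : ℝ, 0 < y → ∀ B : ℝ,
        ((h + b) * B ^ 2 / (2 * R * y) - h * B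
            + (h * P1 / 2 + h * A1 * D + h_d * (P2 - A1 * D)) * P3 * y + K * D * P3 / y
          ≥ P3 * Real.sqrt (2 * K * D *
              (h * P1 + 2 * h * A1 * D + 2 * h_d * (P2 - A1 * D)
                - h ^ 2 * R / ((h + b) * P3))))
        ∧ ((h + b) * B ^ 2 / (2 * R * y) - h * B
            + (h * P1 / 2 + h * A1 * D + h_d * (P2 - A1 * D)) * P3 * y + K * D * P3 / y
          = P3 * Real.sqrt (2 * K * D *
              (h * P1 + 2 * h * A1 * D + 2 * h_d * (P2 - A1 * D)
                - h ^ 2 * R / ((h + b) * P3)))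
          ↔ y = Real.sqrt (2 * K * D /
                (h * P1 + 2 * h * A1 * D + 2 * h_d * (P2 - A1 * D)
                  - h ^ 2 * R / ((h + b) * P3)))
            ∧ B = h * R * Real.sqrt (2 * K * D /
                (h * P1 + 2 * h * A1 * D + 2 * h_d * (P2 - A1 * D)
                  - h ^ 2 * R / ((h + b) * P3))) / (h + b)) := by
  have hhb : 0 < h + b := by positivity
  have hG : 2 * (h * P1 / 2 + h * A1 * D + h_d * (P2 - A1 * D)) - h ^ 2 * R / ((h + b) * P3)
      = h * P1 + 2 * h * A1 * D + 2 * h_d * (P2 - A1 * D)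
        - h ^ 2 * R / ((h + b) * P3) := by ring
  generalize h * P1 + 2 * h * A1 * D + 2 * h_d * (P2 - A1 * D)
    - h ^ 2 * R / ((h + b) * P3) = M at hM hG ⊢
  generalize h * P1 / 2 + h * A1 * D + h_d * (P2 - A1 * D) = G at hG ⊢
  have hs : 0 < Real.sqrt (2 * K * D / M) := by positivity
  have hsq : M * Real.sqrt (2 * K * D / M) ^ 2 = 2 * K * D := by
    rw [Real.sq_sqrt (by positivity)]
    field_simp
  have hroot : Real.sqrt (2 * K * D * M) = M * Real.sqrt (2 * K * D / M) := by
    rw [Real.sqrt_eq_iff_mul_self_eq (by positivity) (by positivity)]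
    linear_combination -M * hsq
  rw [hroot]
  generalize Real.sqrt (2 * K * D / M) = s at hs hsq ⊢
  have key {y : ℝ} (hy : 0 < y) :=
    cost_eq_add_squares hhb.ne' hP3.ne' hR.ne' hy.ne' hG hsq
  refine ⟨?_, fun y hy B => ?_⟩
  · beta_reduce
    rw [key hs]
    ring
  · rw [key hy B]
    have hc : 0 < (h + b) / (2 * R * y) := by positivity
    have hd : 0 < P3 * M / (2 * y) := by positivity
    have hB := mul_nonneg hc.le (sq_nonneg (B - h * R * y / (h + b)))
    have hY := mul_nonneg hd.le (sq_nonneg (y - s))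
    refine ⟨by linarith, fun heq => ?_, ?_⟩
    · have hB0 : (h + b) / (2 * R * y) * (B - h * R * y / (h + b)) ^ 2 = 0 := by linarith
      have hY0 : P3 * M / (2 * y) * (y - s) ^ 2 = 0 := by linarith
      have hys : y = s :=
        sub_eq_zero.mp (pow_eq_zero_iff two_ne_zero |>.mp
          ((mul_eq_zero.mp hY0).resolve_left hd.ne'))
      have hBy : B = h * R * y / (h + b) :=
        sub_eq_zero.mp (pow_eq_zero_iff two_ne_zero |>.mp
          ((mul_eq_zero.mp hB0).resolve_left hc.ne'))
      exact ⟨hys, hys ▸ hBy⟩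
    · rintro ⟨rfl, rfl⟩
      ring
end

section
/- The function f(y,B), viewed as a function of the pair (y,B) ∈ ℝ², is strictly convex on the convex open half-plane {(y,B) ∈ ℝ² : y > 0}. -/
/-- The perspective-type function `(y, B) ↦ (m B² + n) / y` with `m, n > 0` is strictly convex on
the open half-plane `{y > 0}`. -/
theorem strictConvexOn_mul_sq_add_div {m n : ℝ} (hm : 0 < m) (hn : 0 < n) :
    StrictConvexOn ℝ {p : ℝ × ℝ | 0 < p.1} (fun p : ℝ × ℝ => (m * p.2 ^ 2 + n) / p.1) := by
  refine ⟨convex_halfSpace_gt (LinearMap.fst ℝ ℝ ℝ).isLinear 0, ?_⟩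
  rintro ⟨y, B⟩ hy ⟨z, C⟩ hz hne s t hs ht hst
  simp only [Set.mem_ofPred_eq] at hy hz
  simp only [Prod.smul_mk, Prod.mk_add_mk, smul_eq_mul]
  have hw : 0 < s * y + t * z := by positivity
  have key : s * ((m * B ^ 2 + n) / y) + t * ((m * C ^ 2 + n) / z)
      - (m * (s * B + t * C) ^ 2 + n) / (s * y + t * z)
      = s * t * (m * (B * z - C * y) ^ 2 + n * (y - z) ^ 2) / (y * z * (s * y + t * z)) := by
    obtain rfl : t = 1 - s := by linarith
    field_simp
    ring
  have hpos : 0 < m * (B * z - C * y) ^ 2 + n * (y - z) ^ 2 := by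
    rcases eq_or_ne y z with rfl | hyz
    · have hBC : B - C ≠ 0 := fun h => hne (by rw [sub_eq_zero.mp h])
      have : B * y - C * y ≠ 0 := by
        rw [← sub_mul]
        exact mul_ne_zero hBC hy.ne'
      positivity
    · have : y - z ≠ 0 := sub_ne_zero.mpr hyz
      positivity
  rw [← sub_pos, key]
  positivity

/-- `f` is strictly convex on the open half-plane `{(y,B) : y > 0}`. -/
theorem stmt_4 (h b K D P3 R : ℝ) (hh : 0 < h) (hb : 0 < b) (hK : 0 < K)
    (hD : 0 < D) (hP3 : 0 < P3) (hR : 0 < R) (P1 P2 A1 h_d : ℝ) :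
    StrictConvexOn ℝ {p : ℝ × ℝ | 0 < p.1}
      (fun p : ℝ × ℝ =>
        (h + b) * p.2 ^ 2 / (2 * R * p.1) - h * p.2
          + (h * P1 / 2 + h * A1 * D + h_d * (P2 - A1 * D)) * P3 * p.1
          + K * D * P3 / p.1) := by
  have hsc := strictConvexOn_mul_sq_add_div (m := (h + b) / (2 * R)) (n := K * D * P3)
    (by positivity) (by positivity)
  refine (hsc.add_convexOn (LinearMap.convexOn
    (((h * P1 / 2 + h * A1 * D + h_d * (P2 - A1 * D)) * P3) • LinearMap.fst ℝ ℝ ℝ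
      - h • LinearMap.snd ℝ ℝ ℝ) hsc.1)).congr ?_
  rintro ⟨y, B⟩ hy
  have hy' : y ≠ 0 := ne_of_gt hy
  simp only [Pi.add_apply, LinearMap.sub_apply, LinearMap.smul_apply, LinearMap.fst_apply,
    LinearMap.snd_apply, smul_eq_mul]
  field_simp
  ring
end

section
/- Assume M := h·P1 + 2·h·A1·D + 2·h_d·(P2 − A1·D) − h²·R/((h+b)·P3) > 0, and set y* := √(2·K·D/M) and B* := h·R·y*/(h+b). Then for y > 0 and B ∈ ℝ, the system of first-order conditions (h+b)·B/(R·y) − h = 0 and −(h+b)·B²/(2·R·y²) + G·P3 − K·D·P3/y² = 0 holds if and only if y = y* and B = B*. -/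
/-- First-order conditions hold iff `(y,B) = (y*, B*)`. -/
theorem stmt_6 (h b K D P3 R : ℝ) (hh : 0 < h) (hb : 0 < b) (hK : 0 < K)
    (hD : 0 < D) (hP3 : 0 < P3) (hR : 0 < R) (P1 P2 A1 h_d : ℝ)
    (hM : 0 < h * P1 + 2 * h * A1 * D + 2 * h_d * (P2 - A1 * D)
        - h ^ 2 * R / ((h + b) * P3)) :
    ∀ y : ℝ, 0 < y → ∀ B : ℝ,
      ((h + b) * B / (R * y) - h = 0
        ∧ -((h + b) * B ^ 2 / (2 * R * y ^ 2))
            + (h * P1 / 2 + h * A1 * D + h_d * (P2 - A1 * D)) * P3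
            - K * D * P3 / y ^ 2 = 0)
      ↔ (y = Real.sqrt (2 * K * D /
            (h * P1 + 2 * h * A1 * D + 2 * h_d * (P2 - A1 * D)
              - h ^ 2 * R / ((h + b) * P3)))
        ∧ B = h * R * Real.sqrt (2 * K * D /
            (h * P1 + 2 * h * A1 * D + 2 * h_d * (P2 - A1 * D)
              - h ^ 2 * R / ((h + b) * P3))) / (h + b)) := by
  intro y hy B
  have hhb : 0 < h + b := add_pos hh hb
  set M := h * P1 + 2 * h * A1 * D + 2 * h_d * (P2 - A1 * D)
    - h ^ 2 * R / ((h + b) * P3) with hMdef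
  have backorder_iff : (h + b) * B / (R * y) - h = 0 ↔ B = h * R * y / (h + b) := by
    rw [sub_eq_zero, div_eq_iff (by positivity), eq_div_iff hhb.ne']
    constructor <;> intro hB <;> linear_combination hB
  have period_iff : y = √(2 * K * D / M) ↔ M - 2 * K * D / y ^ 2 = 0 := by
    rw [eq_comm, Real.sqrt_eq_iff_eq_sq (by positivity) hy.le, div_eq_iff hM.ne',
      sub_eq_zero, eq_div_iff (by positivity), eq_comm, mul_comm]
  have reduced : -((h + b) * (h * R * y / (h + b)) ^ 2 / (2 * R * y ^ 2))
      + (h * P1 / 2 + h * A1 * D + h_d * (P2 - A1 * D)) * P3 - K * D * P3 / y ^ 2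
      = P3 / 2 * (M - 2 * K * D / y ^ 2) := by
    rw [hMdef]
    field_simp
    ring
  have second_iff : P3 / 2 * (M - 2 * K * D / y ^ 2) = 0 ↔ y = √(2 * K * D / M) := by
    rw [period_iff, mul_eq_zero, or_iff_right (by positivity)]
  rw [backorder_iff]
  constructor
  · rintro ⟨rfl, hy2⟩
    rw [reduced, second_iff] at hy2
    exact ⟨hy2, by rw [← hy2]⟩
  · rintro ⟨hy2, hB⟩
    rw [← hy2] at hB
    subst hB
    exact ⟨rfl, by rw [reduced, second_iff]; exact hy2⟩
end
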